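/- Let p be a prime with p ≡ 3 (mod 4), let m ≥ 1, and let γ ∈ ℤ[i] be a nonzero Gaussian integer. Let j be the multiplicity of p in γ and set t = min(j, m). Then the quotient of the additive group of ℤ[i]/(p^m) by the image of the multiplication-by-γ endomorphism of ℤ[i]/(p^m) is isomorphic as an abelian group to (ℤ/p^t ℤ) × (ℤ/p^t ℤ). -/

import Mathlib

open GaussianInt

/-- Reduction of the real and imaginary parts of a Gaussian integer modulo `n`. -/
def GaussianInt.reImMod (n : ℕ) : GaussianInt →+ ZMod n × ZMod n where
  toFun z := ((z.re : ZMod n), (z.im : ZMod n))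
  map_zero' := by simp
  map_add' x y := by simp

theorem GaussianInt.reImMod_surjective (n : ℕ) : Function.Surjective (reImMod n) := by
  rintro ⟨a, b⟩
  obtain ⟨x, rfl⟩ := ZMod.intCast_surjective a
  obtain ⟨y, rfl⟩ := ZMod.intCast_surjective b
  exact ⟨⟨x, y⟩, rfl⟩

theorem GaussianInt.mem_ker_reImMod {n : ℕ} {z : GaussianInt} :
    z ∈ (reImMod n).ker ↔ (n : GaussianInt) ∣ z := by
  have h := Zsqrtd.intCast_dvd (n : ℤ) z
  rw [Int.cast_natCast] at h
  rw [h, AddMonoidHom.mem_ker]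
  simp [reImMod, ZMod.intCast_zmod_eq_zero_iff_dvd]

/-- In a principal ideal domain, if `q` is prime and `γ` has `q`-multiplicity `j`, then the
multiples of `γ` modulo `q ^ m` are exactly the multiples of `q ^ min j m`. -/
theorem Prime.mk_mem_range_mulLeft_iff {R : Type*} [CommRing R] [IsDomain R]
    [IsPrincipalIdealRing R] {q γ : R} (hq : Prime q) {j : ℕ} (m : ℕ)
    (hdvd : q ^ j ∣ γ) (hndvd : ¬ q ^ (j + 1) ∣ γ) (z : R) :
    Ideal.Quotient.mk (Ideal.span {q ^ m}) z ∈
        (AddMonoidHom.mulLeft (Ideal.Quotient.mk (Ideal.span {q ^ m}) γ)).range ↔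
      q ^ min j m ∣ z := by
  have key : Ideal.Quotient.mk (Ideal.span {q ^ m}) z ∈
      (AddMonoidHom.mulLeft (Ideal.Quotient.mk (Ideal.span {q ^ m}) γ)).range ↔
      ∃ w, q ^ m ∣ γ * w - z := by
    rw [AddMonoidHom.mem_range, Ideal.Quotient.mk_surjective.exists]
    simp only [AddMonoidHom.coe_mulLeft, ← map_mul, Ideal.Quotient.eq,
      Ideal.mem_span_singleton]
  rw [key]
  constructor
  · rintro ⟨w, hw⟩
    have h₁ : q ^ min j m ∣ γ * w :=
      ((pow_dvd_pow q (min_le_left j m)).trans hdvd).mul_right w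
    exact (dvd_sub_right h₁).1 ((pow_dvd_pow q (min_le_right j m)).trans hw)
  · intro hz
    rcases le_total j m with hjm | hmj
    · rw [min_eq_left hjm] at hz
      obtain ⟨c, rfl⟩ := hz
      obtain ⟨δ, rfl⟩ := hdvd
      have hδ : ¬ q ∣ δ := fun h => hndvd (by rw [pow_succ]; exact mul_dvd_mul_left _ h)
      obtain ⟨a, b, hab⟩ := ((hq.irreducible.coprime_iff_not_dvd).2 hδ).pow_left (m := m)
      refine ⟨b * c, -(q ^ j * a * c), ?_⟩
      linear_combination (q ^ j * c) * hab
    · rw [min_eq_right hmj] at hz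
      exact ⟨0, by simpa using hz⟩

/-- For a prime `p ≡ 3 mod 4`, `m ≥ 1`, and a nonzero `γ ∈ ℤ[i]` divisible by
`p` with multiplicity exactly `j`, setting `t = min j m`, the cokernel of the
multiplication-by-`γ` endomorphism of the additive group of `ℤ[i]/(p^m)` is isomorphic
as an abelian group to `(ℤ/p^t) × (ℤ/p^t)`. -/
theorem stmt_2 (p : ℕ) (hp : p.Prime) (hp3 : p % 4 = 3) (m : ℕ) (hm : 1 ≤ m)
    (γ : GaussianInt) (hγ : γ ≠ 0) (j : ℕ)
    (hdvd : (p : GaussianInt) ^ j ∣ γ) (hndvd : ¬ (p : GaussianInt) ^ (j + 1) ∣ γ)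
    (t : ℕ) (ht : t = min j m) :
    Nonempty
      (((GaussianInt ⧸ Ideal.span {(p : GaussianInt) ^ m}) ⧸
          (AddMonoidHom.mulLeft
            (Ideal.Quotient.mk (Ideal.span {(p : GaussianInt) ^ m}) γ)).range) ≃+
        (ZMod (p ^ t) × ZMod (p ^ t))) := by
  subst ht
  have : Fact p.Prime := ⟨hp⟩
  have hq : Prime (p : GaussianInt) := GaussianInt.prime_of_nat_prime_of_mod_four_eq_three p hp3
  let I := Ideal.span {(p : GaussianInt) ^ m}
  let H := (AddMonoidHom.mulLeft (Ideal.Quotient.mk I γ)).range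
  let g : GaussianInt →+ (GaussianInt ⧸ I) ⧸ H :=
    (QuotientAddGroup.mk' H).comp (Ideal.Quotient.mk I).toAddMonoidHom
  have hg : Function.Surjective g :=
    (QuotientAddGroup.mk'_surjective H).comp Ideal.Quotient.mk_surjective
  have hker : g.ker = (GaussianInt.reImMod (p ^ min j m)).ker := by
    ext z
    rw [GaussianInt.mem_ker_reImMod, Nat.cast_pow,
      ← hq.mk_mem_range_mulLeft_iff m hdvd hndvd z]
    exact QuotientAddGroup.eq_zero_iff _
  exact ⟨(QuotientAddGroup.quotientKerEquivOfSurjective g hg).symm.trans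
    ((QuotientAddGroup.quotientAddEquivOfEq hker).trans
      (QuotientAddGroup.quotientKerEquivOfSurjective _
        (GaussianInt.reImMod_surjective _)))⟩
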